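/- Let F be a free group and w ∈ F. If w is contained in a free factor A of F (i.e., F = A * B), then the imprimitivity rank of w computed in A equals the imprimitivity rank of w computed in F. -/

import Mathlib

universe u

/-- `w` is a *primitive* element of the subgroup `H`: it is a member of some free basis of `H`. -/
def IsPrimitiveIn {F : Type u} [Group F] (H : Subgroup F) (w : F) : Prop :=
  ∃ (S : Type u) (b : FreeGroupBasis S H) (i : S), (b i : F) = w

/-- `w` is a primitive element of the group `F`: it is a member of some free basis of `F`. -/
def IsPrimitive {F : Type u} [Group F] (w : F) : Prop :=
  ∃ (S : Type u) (b : FreeGroupBasis S F) (i : S), b i = w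

/-- The imprimitivity rank of `w`: the minimal rank of a finitely generated subgroup of `F`
containing `w` in which `w` is not primitive, or `∞` if no such subgroup exists. -/
noncomputable def irank {F : Type u} [Group F] (w : F) : ℕ∞ :=
  sInf {n : ℕ∞ | ∃ m : ℕ, n = (m : ℕ∞) ∧ ∃ H : Subgroup F,
    Nonempty (FreeGroupBasis (Fin m) H) ∧ w ∈ H ∧ ¬ IsPrimitiveIn H w}

/-- A cocycle for an action of `G` on `X`, with values in a group `L`. -/
structure ActionCocycle (G X L : Type*) [Group G] [MulAction G X] [Group L] where
  /-- The underlying function of a cocycle. -/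
  toFun : G → X → L
  map_mul : ∀ g h x, toFun (g * h) x = toFun g (h • x) * toFun h x

namespace ActionCocycle

variable {G X L M : Type*} [Group G] [MulAction G X] [Group L] [Group M]

lemma map_one (c : ActionCocycle G X L) (x : X) : c.toFun 1 x = 1 := by
  simpa using c.map_mul 1 1 x

lemma map_inv (c : ActionCocycle G X L) (g : G) (x : X) :
    c.toFun g⁻¹ x = (c.toFun g (g⁻¹ • x))⁻¹ := by
  have h := c.map_mul g g⁻¹ x
  rw [mul_inv_cancel, map_one] at h
  exact eq_inv_of_mul_eq_one_right h.symm

/-- The set of group elements at which two cocycles agree, as a subgroup. -/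
def eqLocus (c d : ActionCocycle G X L) : Subgroup G where
  carrier := {g | ∀ x, c.toFun g x = d.toFun g x}
  one_mem' x := by rw [map_one, map_one]
  mul_mem' hg hh x := by rw [map_mul, map_mul, hg, hh]
  inv_mem' hg x := by rw [map_inv, map_inv, hg]

/-- Push a cocycle forward along a homomorphism of coefficient groups. -/
def comp (ρ : L →* M) (c : ActionCocycle G X L) : ActionCocycle G X M where
  toFun g x := ρ (c.toFun g x)
  map_mul g h x := by rw [c.map_mul, _root_.map_mul]

/-- The coboundary of a function `t : X → G`. -/
def coboundary (t : X → G) : ActionCocycle G X G where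
  toFun g x := (t (g • x))⁻¹ * g * t x
  map_mul g h x := by simp only [mul_smul]; group

/-- A cocycle restricts to a homomorphism on a subgroup fixing a point. -/
def homOfFixes (c : ActionCocycle G X L) (H : Subgroup G) (x : X) (hx : ∀ g ∈ H, g • x = x) :
    H →* L where
  toFun g := c.toFun g x
  map_one' := c.map_one x
  map_mul' g h := by rw [Subgroup.coe_mul, c.map_mul, hx h h.2]

/-- The homomorphism to the wreath-like product `(X → L) ⋊ G` determined by a cocycle. -/
def toSemidirect (c : ActionCocycle G X L) : G →* (X → L) ⋊[mulAutArrow] G where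
  toFun g := ⟨fun x ↦ c.toFun g (g⁻¹ • x), g⟩
  map_one' := by
    ext x
    · exact c.map_one _
    · rfl
  map_mul' g h := by
    ext x
    · change c.toFun (g * h) ((g * h)⁻¹ • x) =
        c.toFun g (g⁻¹ • x) * c.toFun h (h⁻¹ • (g⁻¹ • x))
      rw [c.map_mul, mul_inv_rev, mul_smul, smul_inv_smul]
    · rfl

/-- The cocycle determined by a section of `(X → L) ⋊ G → G`. -/
def ofSemidirect (f : G →* (X → L) ⋊[mulAutArrow] G) (hf : ∀ g, (f g).right = g) :
    ActionCocycle G X L where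
  toFun g x := (f g).left (g • x)
  map_mul g h x := by
    rw [_root_.map_mul, SemidirectProduct.mul_left, Pi.mul_apply, hf]
    change _ * (f h).left (g⁻¹ • ((g * h) • x)) = _
    rw [mul_smul, inv_smul_smul]

end ActionCocycle

open Monoid

lemma ActionCocycle.exists_coprod {A B X L : Type*} [Group A] [Group B] [Group L]
    [MulAction (Coprod A B) X] (cA : A → X → L) (cB : B → X → L)
    (hA : ∀ a a' x, cA (a * a') x = cA a ((Coprod.inl a' : Coprod A B) • x) * cA a' x)
    (hB : ∀ b b' x, cB (b * b') x = cB b ((Coprod.inr b' : Coprod A B) • x) * cB b' x) :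
    ∃ c : ActionCocycle (Coprod A B) X L,
      (∀ a, c.toFun (Coprod.inl a) = cA a) ∧ ∀ b, c.toFun (Coprod.inr b) = cB b := by
  let _ : MulAction A X := MulAction.compHom X (Coprod.inl : A →* Coprod A B)
  let _ : MulAction B X := MulAction.compHom X (Coprod.inr : B →* Coprod A B)
  let dA : ActionCocycle A X L := ⟨cA, hA⟩
  let dB : ActionCocycle B X L := ⟨cB, hB⟩
  let fA : A →* (X → L) ⋊[mulAutArrow] Coprod A B :=
    (SemidirectProduct.map (MonoidHom.id _) Coprod.inl fun _ ↦ rfl).comp dA.toSemidirect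
  let fB : B →* (X → L) ⋊[mulAutArrow] Coprod A B :=
    (SemidirectProduct.map (MonoidHom.id _) Coprod.inr fun _ ↦ rfl).comp dB.toSemidirect
  have h : SemidirectProduct.rightHom.comp (Coprod.lift fA fB) = MonoidHom.id _ := by
    ext <;> simp [fA, fB] <;> rfl
  refine ⟨.ofSemidirect (Coprod.lift fA fB) (DFunLike.congr_fun h), fun a ↦ ?_, fun b ↦ ?_⟩
  · ext x
    change (Coprod.lift fA fB (Coprod.inl a)).left _ = _
    rw [Coprod.lift_apply_inl]
    change cA a (a⁻¹ • (a • x)) = _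
    rw [inv_smul_smul]
  · ext x
    change (Coprod.lift fA fB (Coprod.inr b)).left _ = _
    rw [Coprod.lift_apply_inr]
    change cB b (b⁻¹ • (b • x)) = _
    rw [inv_smul_smul]

namespace FreeGroupBasis

lemma exists_actionCocycle {S G X L : Type*} [Group G] [Group L] [MulAction G X]
    (b : FreeGroupBasis S G) (f : S → X → L) :
    ∃ c : ActionCocycle G X L, ∀ s, c.toFun (b s) = f s := by
  let F : G →* (X → L) ⋊[mulAutArrow] G := b.lift fun s ↦ ⟨fun x ↦ f s ((b s)⁻¹ • x), b s⟩
  have hF (s : S) : F (b s) = ⟨fun x ↦ f s ((b s)⁻¹ • x), b s⟩ :=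
    congr_fun (b.lift.symm_apply_apply _) s
  have h : SemidirectProduct.rightHom.comp F = MonoidHom.id _ :=
    b.ext_hom _ _ fun s ↦ by rw [MonoidHom.comp_apply, hF]; rfl
  refine ⟨.ofSemidirect F (DFunLike.congr_fun h), fun s ↦ ?_⟩
  ext x
  change (F (b s)).left (b s • x) = _
  simp [hF]

lemma closure_range {S G : Type*} [Group G] (b : FreeGroupBasis S G) :
    Subgroup.closure (Set.range b) = ⊤ := by
  have h : Set.range b = b.repr.symm.toMonoidHom '' Set.range FreeGroup.of := by
    rw [← Set.range_comp]; rfl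
  rw [h, ← MonoidHom.map_closure, FreeGroup.closure_range_of, ← MonoidHom.range_eq_map]
  exact MonoidHom.range_eq_top.2 b.repr.symm.surjective

/-- The union of bases of `G` and `H` is a basis of the free product `G * H`. -/
def coprod {S T G H : Type*} [Group G] [Group H] (b : FreeGroupBasis S G)
    (c : FreeGroupBasis T H) : FreeGroupBasis (S ⊕ T) (Coprod G H) :=
  have hb (f : S → FreeGroup (S ⊕ T)) (s : S) : b.lift f (b s) = f s :=
    congr_fun (b.lift.symm_apply_apply f) s
  have hc (f : T → FreeGroup (S ⊕ T)) (t : T) : c.lift f (c t) = f t :=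
    congr_fun (c.lift.symm_apply_apply f) t
  ofRepr <| MonoidHom.toMulEquiv
    (Coprod.lift (b.lift fun s ↦ FreeGroup.of (.inl s)) (c.lift fun t ↦ FreeGroup.of (.inr t)))
    (FreeGroup.lift (Sum.elim (fun s ↦ Coprod.inl (b s)) fun t ↦ Coprod.inr (c t)))
    (by
      refine Coprod.hom_ext (b.ext_hom _ _ fun s ↦ ?_) (c.ext_hom _ _ fun t ↦ ?_)
      · simp only [MonoidHom.comp_apply, Coprod.lift_apply_inl, hb]
        simp
      · simp only [MonoidHom.comp_apply, Coprod.lift_apply_inr, hc]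
        simp)
    (by
      refine FreeGroup.ext_hom _ _ fun i ↦ ?_
      rcases i with s | t
      · simp only [MonoidHom.comp_apply, FreeGroup.lift_apply_of, Sum.elim_inl,
          Coprod.lift_apply_inl, hb, MonoidHom.id_apply]
      · simp only [MonoidHom.comp_apply, FreeGroup.lift_apply_of, Sum.elim_inr,
          Coprod.lift_apply_inr, hc, MonoidHom.id_apply])

lemma coprod_inl {S T G H : Type*} [Group G] [Group H] (b : FreeGroupBasis S G)
    (c : FreeGroupBasis T H) (s : S) : b.coprod c (.inl s) = Coprod.inl (b s) := by
  change FreeGroup.lift (Sum.elim (fun s ↦ Coprod.inl (b s)) fun t ↦ Coprod.inr (c t))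
    (FreeGroup.of (.inl s)) = _
  rw [FreeGroup.lift_apply_of, Sum.elim_inl]

/-- A Schreier transversal for a transitive action of a free group: `t` is built along a spanning
tree of the Schreier graph, whence the induction principle. -/
lemma exists_schreier_transversal {S G X : Type*} [Group G] [MulAction G X]
    [MulAction.IsPretransitive G X] (b : FreeGroupBasis S G) (x₀ : X) :
    ∃ t : X → G, t x₀ = 1 ∧ (∀ x, t x • x₀ = x) ∧
      ∀ p : X → Prop, p x₀ →
        (∀ s y, t (b s • y) = b s * t y → (p y ↔ p (b s • y))) → ∀ x, p x := by
  classical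
  let ev (l : List (S × Bool)) : G := b.repr.symm (FreeGroup.mk l)
  have hex (x : X) : ∃ n, ∃ l : List (S × Bool), l.length = n ∧ ev l • x₀ = x := by
    obtain ⟨g, hg⟩ := MulAction.exists_smul_eq G x₀ x
    exact ⟨_, (b.repr g).toWord, rfl, by simpa [ev, FreeGroup.mk_toWord] using hg⟩
  let d (x : X) : ℕ := Nat.find (hex x)
  have hstep (x : X) (hx : x ≠ x₀) : ∃ (g : G) (y : X), d y < d x ∧ g • y = x ∧
      ∃ s, g = b s ∨ g = (b s)⁻¹ := by
    obtain ⟨l, hl, hlx⟩ := Nat.find_spec (hex x)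
    rcases l with _ | ⟨⟨s, ε⟩, l⟩
    · exact absurd (hlx.symm.trans (by rw [show ev [] = 1 from map_one _, one_smul])) hx
    · have hcons : ev ((s, ε) :: l) = ev [(s, ε)] * ev l := by
        simp only [ev, ← map_mul, FreeGroup.mul_mk, List.singleton_append]
      refine ⟨ev [(s, ε)], ev l • x₀, ?_, by rw [← mul_smul, ← hcons, hlx], s, ?_⟩
      · refine (Nat.find_min' (hex _) ⟨l, rfl, rfl⟩).trans_lt ?_
        change _ < Nat.find (hex x)
        rw [← hl]
        simp
      · cases ε
        · right
          change b.repr.symm _ = (b.repr.symm _)⁻¹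
          rw [← map_inv]
          rfl
        · exact Or.inl rfl
  choose! g y hd hgy hs using hstep
  let t : X → G := (measure d).wf.fix fun x ih ↦
    if hx : x = x₀ then 1 else g x * ih (y x) (hd x hx)
  have ht (x : X) : t x = if x = x₀ then 1 else g x * t (y x) := by
    by_cases hx : x = x₀
    · rw [if_pos hx]
      exact ((measure d).wf.fix_eq _ x).trans (dif_pos hx)
    · rw [if_neg hx]
      exact ((measure d).wf.fix_eq _ x).trans (dif_neg hx)
  refine ⟨t, by rw [ht, if_pos rfl], fun x ↦ ?_, fun p h₀ hp x ↦ ?_⟩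
  · induction x using (measure d).wf.induction with
    | _ x ih =>
      rw [ht]
      split_ifs with hx
      · rw [one_smul, hx]
      · rw [mul_smul, ih _ (hd x hx), hgy x hx]
  · induction x using (measure d).wf.induction with
    | _ x ih =>
      by_cases hx : x = x₀
      · rwa [hx]
      have hy := ih _ (hd x hx)
      have htx := ht x
      have hxy := hgy x hx
      rw [if_neg hx] at htx
      obtain ⟨s, hs | hs⟩ := hs x hx <;> rw [hs] at htx hxy
      · rw [← hxy] at htx ⊢
        refine (hp s (y x) ?_).1 hy
        rw [hxy] at htx ⊢
        exact htx
      · rw [inv_smul_eq_iff] at hxy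
        refine (hp s x ?_).2 (hxy ▸ hy)
        rw [← hxy, htx, mul_inv_cancel_left]

end FreeGroupBasis

section Primitive

/-- A basis element of a free group that lies in a subgroup is primitive in that subgroup. -/
lemma FreeGroupBasis.isPrimitiveIn {S F : Type u} [Group F] (b : FreeGroupBasis S F)
    (H : Subgroup F) (s₀ : S) (hs : b s₀ ∈ H) : IsPrimitiveIn H (b s₀) := by
  classical
  let x₀ : F ⧸ H := ((1 : F) : F ⧸ H)
  have hfix (g : F) : g • x₀ = x₀ ↔ g ∈ H := by
    rw [eq_comm]
    change ((1 : F) : F ⧸ H) = ((g * 1 : F) : F ⧸ H) ↔ _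
    rw [QuotientGroup.eq]
    simp
  obtain ⟨t, ht₀, ht, hind⟩ := b.exists_schreier_transversal x₀
  let c := ActionCocycle.coboundary t
  have hcH (g : F) (x : F ⧸ H) : c.toFun g x ∈ H := by
    rw [← hfix]
    change ((t (g • x))⁻¹ * g * t x) • x₀ = x₀
    rw [mul_smul, mul_smul, ht, inv_smul_eq_iff, ht]
  let E : Set ((F ⧸ H) × S) := {e | c.toFun (b e.2) e.1 ≠ 1}
  obtain ⟨k, hk⟩ := b.exists_actionCocycle (X := F ⧸ H) (L := FreeGroup E)
    fun s x ↦ if h : (x, s) ∈ E then FreeGroup.of ⟨(x, s), h⟩ else 1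
  let ψ : FreeGroup E →* H := FreeGroup.lift fun e ↦ ⟨c.toFun (b e.1.2) e.1.1, hcH _ _⟩
  have hψ (e : E) : (ψ (FreeGroup.of e) : F) = c.toFun (b e.1.2) e.1.1 := by simp [ψ]
  have hψk (g : F) (x : F ⧸ H) : H.subtype (ψ (k.toFun g x)) = c.toFun g x := by
    have : ((k.comp (H.subtype.comp ψ)).eqLocus c) = ⊤ := by
      rw [eq_top_iff, ← b.closure_range, Subgroup.closure_le]
      rintro _ ⟨s, rfl⟩ x
      change ((ψ (k.toFun (b s) x) : H) : F) = _
      rw [hk]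
      dsimp only
      split_ifs with h
      · exact hψ _
      · rw [map_one]
        exact (not_not.1 h).symm
    exact (this ▸ Subgroup.mem_top g : g ∈ (k.comp (H.subtype.comp ψ)).eqLocus c) x
  have hkt (x : F ⧸ H) : k.toFun (t x) x₀ = 1 := by
    refine hind (fun x ↦ k.toFun (t x) x₀ = 1) (by rw [ht₀, k.map_one]) (fun s y hy ↦ ?_) x
    have hE : (y, s) ∉ E := by
      rw [Set.mem_ofPred_eq, not_not]
      change (t (b s • y))⁻¹ * b s * t y = 1
      rw [hy]
      group
    rw [hy, k.map_mul, ht, congr_fun (hk s) y, dif_neg hE, one_mul]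
  let φ : H →* FreeGroup E := k.homOfFixes H x₀ fun g hg ↦ (hfix g).2 hg
  have hψφ : ψ.comp φ = MonoidHom.id H := by
    ext h
    refine (hψk h x₀).trans ?_
    change (t ((h : F) • x₀))⁻¹ * h * t x₀ = h
    rw [(hfix h).2 h.2, ht₀]
    group
  have hφψ : φ.comp ψ = MonoidHom.id _ := by
    ext e
    change k.toFun ((ψ (FreeGroup.of e) : H) : F) x₀ = FreeGroup.of e
    rw [hψ]
    change k.toFun ((t (b e.1.2 • e.1.1))⁻¹ * b e.1.2 * t e.1.1) x₀ = _
    rw [k.map_mul, k.map_mul, ht, hkt, mul_one, k.map_inv, congr_fun (hk _) _, dif_pos e.2,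
      inv_smul_eq_iff.2 (ht _).symm, hkt, inv_one, one_mul]
  have he₀ : c.toFun (b s₀) x₀ = b s₀ := by
    change (t (b s₀ • x₀))⁻¹ * b s₀ * t x₀ = _
    rw [(hfix _).2 hs, ht₀]
    group
  have hne : b s₀ ≠ 1 := fun h ↦ FreeGroup.of_ne_one s₀ (by rw [← b.repr_apply_coe, h, map_one])
  refine ⟨E, .ofRepr (MonoidHom.toMulEquiv φ ψ hψφ hφψ), ⟨(x₀, s₀), ?_⟩, ?_⟩
  · change c.toFun (b s₀) x₀ ≠ 1
    rwa [he₀]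
  · exact (hψ _).trans he₀

lemma isPrimitiveIn_map_iff {F G : Type u} [Group F] [Group G] {f : F →* G}
    (hf : Function.Injective f) {H : Subgroup F} {w : F} (hw : w ∈ H) :
    IsPrimitiveIn (H.map f) (f w) ↔ IsPrimitiveIn H w := by
  let e := H.equivMapOfInjective f hf
  constructor
  · rintro ⟨S, b, i, hi⟩
    refine ⟨S, b.map e.symm, i, ?_⟩
    have : b i = e ⟨w, hw⟩ := Subtype.ext hi
    rw [FreeGroupBasis.map_apply, this, e.symm_apply_apply]
  · rintro ⟨S, b, i, hi⟩
    refine ⟨S, b.map e, i, ?_⟩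
    rw [FreeGroupBasis.map_apply, ← hi]
    rfl

lemma IsPrimitiveIn.of_injective {F L : Type u} [Group F] [Group L] {H : Subgroup F}
    {φ : H →* L} (hφ : Function.Injective φ) {w : H} {S : Type u} (b : FreeGroupBasis S L) {s : S}
    (hs : b s = φ w) : IsPrimitiveIn H (w : F) := by
  have h := b.isPrimitiveIn φ.range s (hs ▸ ⟨w, rfl⟩)
  rw [hs, MonoidHom.range_eq_map, isPrimitiveIn_map_iff hφ (Subgroup.mem_top w)] at h
  rw [← isPrimitiveIn_map_iff H.subtype_injective (Subgroup.mem_top w), ← MonoidHom.range_eq_map,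
    H.range_subtype] at h
  exact h

/-- A subgroup `H` of `A * B` embeds in `P * (A * B)` for every subgroup `P` of `A` containing
`H ∩ A`, in such a way that `H ∩ A` is mapped identically into the first factor. -/
lemma exists_injective_hom_coprod {A B : Type*} [Group A] [Group B] {H : Subgroup (Coprod A B)}
    {P : Subgroup A} (hP : H.comap Coprod.inl ≤ P) :
    ∃ φ : H →* Coprod P (Coprod A B), Function.Injective φ ∧
      ∀ (a : A) (ha : Coprod.inl a ∈ H), φ ⟨Coprod.inl a, ha⟩ = Coprod.inl ⟨a, hP ha⟩ := by
  classical
  let X := Coprod A B ⧸ H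
  let x₀ : X := ((1 : Coprod A B) : Coprod A B ⧸ H)
  have hfix (g : Coprod A B) : g • x₀ = x₀ ↔ g ∈ H := by
    rw [eq_comm]
    change ((1 : Coprod A B) : Coprod A B ⧸ H) = ((g * 1 : Coprod A B) : Coprod A B ⧸ H) ↔ _
    rw [QuotientGroup.eq]
    simp
  let C : Set X := {x | ∃ a : A, (Coprod.inl a : Coprod A B) • x₀ = x}
  have hC (a : A) (x : X) : (Coprod.inl a : Coprod A B) • x ∈ C ↔ x ∈ C := by
    constructor
    · rintro ⟨a', h⟩
      exact ⟨a⁻¹ * a', by rw [map_mul, mul_smul, h, map_inv, inv_smul_smul]⟩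
    · rintro ⟨a', rfl⟩
      exact ⟨a * a', by rw [map_mul, mul_smul]⟩
  have htex (x : X) : ∃ g : Coprod A B, g • x₀ = x ∧ (x = x₀ → g = 1) ∧
      (x ∈ C → ∃ a : A, Coprod.inl a = g) := by
    by_cases hx : x = x₀
    · exact ⟨1, by rw [one_smul, hx], fun _ ↦ rfl, fun _ ↦ ⟨1, map_one _⟩⟩
    by_cases hxC : x ∈ C
    · obtain ⟨a, ha⟩ := hxC
      exact ⟨Coprod.inl a, ha, fun h ↦ absurd h hx, fun _ ↦ ⟨a, rfl⟩⟩
    · obtain ⟨g, hg⟩ := MulAction.exists_smul_eq (Coprod A B) x₀ x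
      exact ⟨g, hg, fun h ↦ absurd h hx, fun h ↦ absurd h hxC⟩
  choose t ht ht₀ htC using htex
  let c := ActionCocycle.coboundary t
  have hcA (a : A) (x : X) (hx : x ∈ C) :
      ∃ p : P, Coprod.inl (p : A) = c.toFun (Coprod.inl a) x := by
    obtain ⟨a₁, h₁⟩ := htC x hx
    obtain ⟨a₂, h₂⟩ := htC _ ((hC a x).2 hx)
    have h : Coprod.inl (a₂⁻¹ * a * a₁) = c.toFun (Coprod.inl a) x := by
      rw [map_mul, map_mul, map_inv, h₁, h₂]
      rfl
    refine ⟨⟨a₂⁻¹ * a * a₁, hP ?_⟩, h⟩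
    rw [Subgroup.mem_comap, h, ← hfix]
    change ((t (_ • x))⁻¹ * _ * t x) • x₀ = x₀
    rw [mul_smul, mul_smul, ht, inv_smul_eq_iff, ht]
  choose! p hp using hcA
  have hp_mul (a a' : A) (x : X) (hx : x ∈ C) :
      p (a * a') x = p a ((Coprod.inl a' : Coprod A B) • x) * p a' x := by
    apply Subtype.ext
    apply Coprod.inl_injective (N := B)
    rw [Subgroup.coe_mul, map_mul, hp _ _ hx, hp _ _ hx, hp _ _ ((hC _ _).2 hx), map_mul, c.map_mul]
  obtain ⟨k, hkA, hkB⟩ := ActionCocycle.exists_coprod (X := X) (L := Coprod P (Coprod A B))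
    (fun (a : A) x ↦
      if x ∈ C then Coprod.inl (p a x) else Coprod.inr (c.toFun (Coprod.inl a) x))
    (fun (b : B) x ↦ Coprod.inr (c.toFun (Coprod.inr b) x))
    (fun a a' x ↦ by
      simp only [hC]
      split_ifs with hx
      · rw [hp_mul a a' x hx, map_mul]
      · rw [map_mul, c.map_mul, map_mul])
    (fun b b' x ↦ by rw [map_mul, c.map_mul, map_mul])
  let ρ : Coprod P (Coprod A B) →* Coprod A B :=
    Coprod.lift (Coprod.inl.comp P.subtype) (MonoidHom.id _)
  have hρk (g : Coprod A B) (x : X) : ρ (k.toFun g x) = c.toFun g x := by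
    have : (k.comp ρ).eqLocus c = ⊤ := by
      rw [eq_top_iff, ← Coprod.range_inl_sup_range_inr, sup_le_iff]
      constructor
      · rintro _ ⟨a, rfl⟩ x
        change ρ (k.toFun _ x) = _
        rw [hkA]
        dsimp only
        split_ifs with hx
        · exact hp a x hx
        · rfl
      · rintro _ ⟨b, rfl⟩ x
        change ρ (k.toFun _ x) = _
        rw [hkB]
        rfl
    exact (this ▸ Subgroup.mem_top g : g ∈ (k.comp ρ).eqLocus c) x
  have hc (g : Coprod A B) (hg : g ∈ H) : c.toFun g x₀ = g := by
    change (t (g • x₀))⁻¹ * g * t x₀ = g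
    rw [(hfix g).2 hg, ht₀ _ rfl]
    group
  refine ⟨k.homOfFixes H x₀ fun g hg ↦ (hfix g).2 hg, fun g h hgh ↦ ?_, fun a ha ↦ ?_⟩
  · have := congr_arg ρ (show k.toFun g x₀ = k.toFun h x₀ from hgh)
    rw [hρk, hρk, hc _ g.2, hc _ h.2] at this
    exact Subtype.ext this
  · have hx₀ : x₀ ∈ C := ⟨1, by rw [map_one, one_smul]⟩
    change k.toFun (Coprod.inl a) x₀ = _
    rw [hkA]
    dsimp only
    rw [if_pos hx₀]
    congr 1
    apply Subtype.ext
    apply Coprod.inl_injective (N := B)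
    rw [hp _ _ hx₀, hc _ ha]

lemma isPrimitiveIn_of_comap_inl_le {A B : Type u} [Group A] [Group B] [IsFreeGroup A]
    [IsFreeGroup B] {H : Subgroup (Coprod A B)} {P : Subgroup A} (hP : H.comap Coprod.inl ≤ P)
    {w : A} (hw : Coprod.inl w ∈ H) (h : IsPrimitiveIn P w) :
    IsPrimitiveIn H (Coprod.inl w : Coprod A B) := by
  obtain ⟨φ, hφ, hφw⟩ := exists_injective_hom_coprod hP
  obtain ⟨S, b, i, hi⟩ := h
  refine IsPrimitiveIn.of_injective (w := ⟨_, hw⟩) hφ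
    (b.coprod ((IsFreeGroup.basis A).coprod (IsFreeGroup.basis B))) (s := .inl i) ?_
  rw [hφw, FreeGroupBasis.coprod_inl]
  exact congr_arg _ (Subtype.ext hi)

end Primitive

lemma FreeGroupBasis.finite_and_card_le_of_surjective {S G K : Type*} [Group G] [Group K] {m : ℕ}
    (b : FreeGroupBasis (Fin m) G) (c : FreeGroupBasis S K) {f : G →* K}
    (hf : Function.Surjective f) : Finite S ∧ Nat.card S ≤ m := by
  let Z := Multiplicative (ZMod 2)
  let r : (S → Z) → (Fin m → Z) := fun v ↦ b.lift.symm ((c.lift v).comp f)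
  have hr : Function.Injective r := fun v v' h ↦
    c.lift.injective ((MonoidHom.cancel_right hf).1 (b.lift.symm.injective h))
  have hfin : Finite (S → Z) := Finite.of_injective r hr
  have hS : Finite S := by
    classical
    refine Finite.of_injective
      (fun s : S ↦ (Pi.mulSingle s (Multiplicative.ofAdd 1) : S → Z)) fun s s' h ↦ ?_
    by_contra hne
    have := congr_fun h s
    simp only [Pi.mulSingle_eq_same, Pi.mulSingle_eq_of_ne hne] at this
    exact absurd this (by decide)
  refine ⟨hS, ?_⟩
  have hcard := Nat.card_le_card_of_injective r hr
  have hZ : Nat.card Z = 2 := by simp [Z]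
  rw [Nat.card_fun, Nat.card_fun, hZ, Nat.card_fin] at hcard
  exact (Nat.pow_le_pow_iff_right one_lt_two).1 hcard

lemma exists_freeGroupBasis_fin_map {G K : Type*} [Group G] [Group K] [IsFreeGroup K]
    {H : Subgroup G} {m : ℕ} (b : FreeGroupBasis (Fin m) H) (f : G →* K) :
    ∃ k ≤ m, Nonempty (FreeGroupBasis (Fin k) (H.map f)) := by
  obtain ⟨hfin, hcard⟩ := b.finite_and_card_le_of_surjective (IsFreeGroup.basis (H.map f))
    (f.subgroupMap_surjective H)
  exact ⟨_, hcard, ⟨(IsFreeGroup.basis (H.map f)).reindex (Finite.equivFin _)⟩⟩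

open Monoid in
/-- If `w` lies in a free factor `A` of the free group `F = A * B`, then the imprimitivity rank
of `w` computed in `A` equals the imprimitivity rank of `w` computed in `F`. -/
theorem irank_coprod_inl {A B : Type u} [Group A] [Group B] [IsFreeGroup A] [IsFreeGroup B]
    (w : A) :
    irank ((Coprod.inl : A →* Coprod A B) w) = irank w := by
  apply le_antisymm
  · refine le_sInf ?_
    rintro _ ⟨m, rfl, H, ⟨b⟩, hw, hprim⟩
    refine sInf_le ⟨m, rfl, H.map Coprod.inl, ⟨b.map ?_⟩, ⟨w, hw, rfl⟩, fun h ↦ hprim ?_⟩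
    · exact H.equivMapOfInjective _ Coprod.inl_injective
    · exact (isPrimitiveIn_map_iff Coprod.inl_injective hw).1 h
  · refine le_sInf ?_
    rintro _ ⟨m, rfl, H, ⟨b⟩, hw, hprim⟩
    obtain ⟨k, hk, hb⟩ := exists_freeGroupBasis_fin_map b Coprod.fst
    have hwP : w ∈ H.map (Coprod.fst : Coprod A B →* A) := ⟨_, hw, Coprod.fst_apply_inl w⟩
    have hP : H.comap Coprod.inl ≤ H.map (Coprod.fst : Coprod A B →* A) :=
      fun a ha ↦ ⟨_, ha, Coprod.fst_apply_inl a⟩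
    refine le_trans (sInf_le ?_) (Nat.cast_le.2 hk)
    exact ⟨k, rfl, _, hb, hwP, fun h ↦ hprim (isPrimitiveIn_of_comap_inl_le hP hw h)⟩
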